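/- arXiv:1509.07714 — 3 statements merged into one kernel-verified Lean document; each statement's English description precedes it below -/
import Mathlib

section
/- If n₁n₂ ≡ 1 (mod 12), then Λ(β)·(Λ(β)+1) equals the image of the integer (n−1)/4 in GF(q^m). If n₁n₂ ≡ 7 (mod 12), then Λ(β)·(Λ(β)+1) equals the image of the integer −(n+1)/4 in GF(q^m). -/
/-- For nontrivial additive characters of two finite fields, the character sum over the pairs
`(a, b)` that lie on the axis `a = 0`, `b ≠ 0` or have product of quadratic characters `-1`
is determined by the product of the two quadratic Gauss sums. -/
theorem two_mul_sum_filter_quadraticChar_add_one {K L R : Type*} [Field K] [Fintype K]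
    [DecidableEq K] [Field L] [Fintype L] [DecidableEq L] [CommRing R] [IsDomain R]
    (φ : AddChar K R) (ψ : AddChar L R) (hφ : φ ≠ 1) (hψ : ψ ≠ 1) :
    2 * ∑ z : K × L with (z.1 = 0 ∧ z.2 ≠ 0) ∨ quadraticChar K z.1 * quadraticChar L z.2 = -1,
        φ z.1 * ψ z.2 + 1 =
      -(gaussSum ((quadraticChar K).ringHomComp (Int.castRingHom R)) φ *
        gaussSum ((quadraticChar L).ringHomComp (Int.castRingHom R)) ψ) := by
  have hφ0 : ∑ a : K, (if a = 0 then 0 else φ a) = -1 := by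
    have h := AddChar.sum_eq_zero_of_ne_one hφ
    have h' : ∑ a : K, (if a = 0 then 0 else φ a) + ∑ a : K, (if a = 0 then (1 : R) else 0) =
        ∑ a, φ a := by
      rw [← Finset.sum_add_distrib]
      refine Finset.sum_congr rfl fun a _ ↦ ?_
      split_ifs with ha <;> simp [ha]
    rw [h, Finset.sum_ite_eq' Finset.univ 0] at h'
    simpa using eq_neg_of_add_eq_zero_left h'
  have hψ0 : ∑ a : L, (if a = 0 then 0 else ψ a) = -1 := by
    have h := AddChar.sum_eq_zero_of_ne_one hψ
    have h' : ∑ a : L, (if a = 0 then 0 else ψ a) + ∑ a : L, (if a = 0 then (1 : R) else 0) =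
        ∑ a, ψ a := by
      rw [← Finset.sum_add_distrib]
      refine Finset.sum_congr rfl fun a _ ↦ ?_
      split_ifs with ha <;> simp [ha]
    rw [h, Finset.sum_ite_eq' Finset.univ 0] at h'
    simpa using eq_neg_of_add_eq_zero_left h'
  have key : 2 * ∑ z : K × L with (z.1 = 0 ∧ z.2 ≠ 0) ∨
        quadraticChar K z.1 * quadraticChar L z.2 = -1, φ z.1 * ψ z.2 =
      2 * ((∑ a : K, (if a = 0 then 1 else 0)) * ∑ b : L, (if b = 0 then 0 else ψ b)) +
      (∑ a : K, (if a = 0 then 0 else φ a)) * (∑ b : L, (if b = 0 then 0 else ψ b)) -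
      gaussSum ((quadraticChar K).ringHomComp (Int.castRingHom R)) φ *
        gaussSum ((quadraticChar L).ringHomComp (Int.castRingHom R)) ψ := by
    simp only [gaussSum, Fintype.sum_mul_sum, ← Fintype.sum_prod_type']
    rw [Finset.sum_filter, Finset.mul_sum, Finset.mul_sum, ← Finset.sum_add_distrib,
      ← Finset.sum_sub_distrib]
    refine Finset.sum_congr rfl ?_
    rintro ⟨a, b⟩ -
    simp only [MulChar.ringHomComp_apply]
    by_cases ha : a = 0
    · by_cases hb : b = 0 <;> simp [ha, hb]
    · by_cases hb : b = 0
      · simp [ha, hb]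
      · rcases quadraticChar_dichotomy ha with h1 | h1 <;>
          rcases quadraticChar_dichotomy hb with h2 | h2 <;>
          simp [ha, hb, h1, h2] <;> ring
  rw [key, hφ0, hψ0, Finset.sum_ite_eq' Finset.univ 0]
  simp
  ring

/-- The square of the quadratic Gauss sum over a prime field of odd order. -/
theorem gaussSum_quadraticChar_zmod_sq {p : ℕ} [Fact p.Prime] (hp : p ≠ 2) {R : Type*} [CommRing R]
    [IsDomain R] [CharZero R] (ψ : AddChar (ZMod p) R) (hψ : ψ ≠ 1) :
    gaussSum ((quadraticChar (ZMod p)).ringHomComp (Int.castRingHom R)) ψ ^ 2 =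
      ((ZMod.χ₄ p : ℤ) : R) * p := by
  have hc : ringChar (ZMod p) ≠ 2 := by rwa [ZMod.ringChar_zmod_n]
  rw [gaussSum_sq ((MulChar.ringHomComp_ne_one_iff Int.cast_injective).2 (quadraticChar_ne_one hc))
    ((quadraticChar_isQuadratic _).comp _) (AddChar.IsPrimitive.of_ne_one hψ)]
  simp [quadraticChar_neg_one hc]

/-- A generator of the unit group of a prime field of odd order is not a square. -/
theorem quadraticChar_eq_neg_one_of_orderOf {p : ℕ} [Fact p.Prime] (hp : p ≠ 2) {g : ZMod p}
    (hg : orderOf g = p - 1) : quadraticChar (ZMod p) g = -1 := by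
  have hp2 := (Fact.out : p.Prime).two_le
  have hc : ringChar (ZMod p) ≠ 2 := by rwa [ZMod.ringChar_zmod_n]
  have hg0 : g ≠ 0 := by
    rintro rfl
    rw [orderOf_zero] at hg
    omega
  refine (quadraticChar_dichotomy hg0).resolve_left fun h ↦ ?_
  have hpow := quadraticChar_eq_pow_of_char_ne_two' hc g
  rw [h, ZMod.card] at hpow
  have hdvd := orderOf_dvd_of_pow_eq_one (by simpa using hpow.symm)
  have := Nat.le_of_dvd (by omega) hdvd
  omega

/-- Every nonzero element of a prime field is a power of an element of order `p - 1`. -/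
theorem exists_pow_eq_of_orderOf {p : ℕ} [Fact p.Prime] {g a : ZMod p}
    (hg : orderOf g = p - 1) (ha : a ≠ 0) : ∃ k : ℕ, g ^ k = a := by
  have hp2 := (Fact.out : p.Prime).two_le
  have hprim : IsPrimitiveRoot g (p - 1) := hg ▸ IsPrimitiveRoot.orderOf g
  have : NeZero (p - 1) := ⟨by omega⟩
  obtain ⟨i, -, hi⟩ := hprim.eq_pow_of_pow_eq_one (ZMod.pow_card_sub_one_eq_one ha)
  exact ⟨i, hi⟩

/-- Integral polynomial identities at a complex primitive root of unity hold at every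
primitive root of unity of the same order. -/
theorem aeval_eq_zero_of_isPrimitiveRoot {n : ℕ} (hn : 0 < n) {F : Type*} [Field F] {ζ : ℂ} {β : F}
    (hζ : IsPrimitiveRoot ζ n) (hβ : IsPrimitiveRoot β n) (f : Polynomial ℤ)
    (hf : Polynomial.aeval ζ f = 0) : Polynomial.aeval β f = 0 := by
  have hdvd : Polynomial.cyclotomic n ℤ ∣ f := by
    rw [Polynomial.cyclotomic_eq_minpoly hζ hn]
    exact minpoly.isIntegrallyClosed_dvd (hζ.isIntegral hn) hf
  obtain ⟨h, rfl⟩ := hdvd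
  have : Polynomial.aeval β (Polynomial.cyclotomic n ℤ) = 0 := by
    have h0 := hβ.isRoot_cyclotomic hn
    rwa [Polynomial.IsRoot, ← Polynomial.map_cyclotomic_int, Polynomial.eval_map, ← algebraMap_int_eq,
      ← Polynomial.aeval_def] at h0
  rw [map_mul, this, zero_mul]

/-- An element of `ZMod (p * q)` vanishes modulo `p` but not modulo `q` exactly when it is
one of the multiples `p, 2p, …, (q - 1)p`. -/
theorem zmod_exists_mul_iff {p q : ℕ} [Fact p.Prime] [Fact q.Prime] (hpq : p ≠ q)
    (x : ZMod (p * q)) :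
    (∃ k : ℕ, 1 ≤ k ∧ k ≤ q - 1 ∧ x = ((k * p : ℕ) : ZMod (p * q))) ↔
      (x.cast : ZMod p) = 0 ∧ (x.cast : ZMod q) ≠ 0 := by
  have hp := (Fact.out : p.Prime)
  have hq := (Fact.out : q.Prime)
  have : NeZero (p * q) := ⟨mul_ne_zero hp.ne_zero hq.ne_zero⟩
  constructor
  · rintro ⟨k, hk1, hk2, rfl⟩
    rw [ZMod.cast_natCast (dvd_mul_right p q), ZMod.cast_natCast (dvd_mul_left q p)]
    refine ⟨by simp, ?_⟩
    rw [Ne, ZMod.natCast_eq_zero_iff, hq.dvd_mul, not_or]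
    refine ⟨fun h ↦ ?_, fun h ↦ hpq ((Nat.prime_dvd_prime_iff_eq hq hp).1 h).symm⟩
    have := Nat.le_of_dvd (by omega) h
    omega
  · rintro ⟨h1, h2⟩
    rw [← ZMod.natCast_val, ZMod.natCast_eq_zero_iff] at h1
    obtain ⟨k, hk⟩ := h1
    have hlt := x.val_lt
    have hx : x = ((k * p : ℕ) : ZMod (p * q)) := by
      rw [mul_comm k, ← hk, ZMod.natCast_zmod_val]
    refine ⟨k, Nat.one_le_iff_ne_zero.2 ?_, ?_, hx⟩
    · rintro rfl
      exact h2 (by rw [hx]; simp)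
    · rw [hk] at hlt
      have := lt_of_mul_lt_mul_left hlt (Nat.zero_le p)
      omega

/-- The union of the odd Whiteman classes of order six is the set where the product of the two
quadratic characters is `-1`. -/
theorem exists_odd_whiteman_iff {p q : ℕ} [Fact p.Prime] [Fact q.Prime] (hpq : p ≠ q)
    (hgcd : Nat.gcd (p - 1) (q - 1) = 6) {g u : ℕ}
    (hg₁ : orderOf (g : ZMod p) = p - 1) (hg₂ : orderOf (g : ZMod q) = q - 1)
    (hu₁ : (u : ZMod p) = (g : ZMod p)) (hu₂ : (u : ZMod q) = 1) (x : ZMod (p * q)) :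
    (∃ i, (i = 1 ∨ i = 3 ∨ i = 5) ∧ ∃ s < (p - 1) * (q - 1) / 6,
        x = (g : ZMod (p * q)) ^ s * (u : ZMod (p * q)) ^ i) ↔
      quadraticChar (ZMod p) x.cast * quadraticChar (ZMod q) x.cast = -1 := by
  have hp2 := (Fact.out : p.Prime).two_le
  have hq2 := (Fact.out : q.Prime).two_le
  have hdp : 6 ∣ p - 1 := hgcd ▸ Nat.gcd_dvd_left _ _
  have hdq : 6 ∣ q - 1 := hgcd ▸ Nat.gcd_dvd_right _ _
  have hχ₁ := quadraticChar_eq_neg_one_of_orderOf (by omega) hg₁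
  have hχ₂ := quadraticChar_eq_neg_one_of_orderOf (by omega) hg₂
  have hcop : Nat.Coprime p q := (Nat.coprime_primes Fact.out Fact.out).2 hpq
  constructor
  · rintro ⟨i, hi, s, -, rfl⟩
    have h1 : (((g : ZMod (p * q)) ^ s * (u : ZMod (p * q)) ^ i).cast : ZMod p) =
        (g : ZMod p) ^ s * (g : ZMod p) ^ i := by
      simp [hu₁]
    have h2 : (((g : ZMod (p * q)) ^ s * (u : ZMod (p * q)) ^ i).cast : ZMod q) =
        (g : ZMod q) ^ s := by
      simp [hu₂]
    rw [h1, h2, map_mul, map_pow, map_pow, map_pow, hχ₁, hχ₂]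
    have hs : ((-1 : ℤ) ^ s) * (-1) ^ s = 1 := by rw [← mul_pow]; simp
    have hi' : (-1 : ℤ) ^ i = -1 := by rcases hi with rfl | rfl | rfl <;> norm_num
    rw [hi']
    linear_combination -hs
  · intro h
    have ha : (x.cast : ZMod p) ≠ 0 := by
      intro h0
      simp [h0] at h
    have hb : (x.cast : ZMod q) ≠ 0 := by
      intro h0
      simp [h0] at h
    obtain ⟨j, hj⟩ := exists_pow_eq_of_orderOf hg₁ ha
    obtain ⟨k, hk⟩ := exists_pow_eq_of_orderOf hg₂ hb
    rw [← hj, ← hk, map_pow, map_pow, hχ₁, hχ₂, ← pow_add, neg_one_pow_eq_neg_one_iff_odd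
      (by norm_num), Nat.odd_iff] at h
    obtain ⟨i, hi, hi6⟩ : ∃ i, (i = 1 ∨ i = 3 ∨ i = 5) ∧ (k + i) % 6 = j % 6 := by
      have : (j + 5 * k) % 6 = 1 ∨ (j + 5 * k) % 6 = 3 ∨ (j + 5 * k) % 6 = 5 := by omega
      exact ⟨_, this, by omega⟩
    have hmod : j + (p - 1) - i ≡ k [MOD Nat.gcd (p - 1) (q - 1)] := by
      rw [hgcd, Nat.ModEq]
      omega
    let s := Nat.chineseRemainder' hmod
    have hlt := Nat.chineseRemainder'_lt_lcm hmod (by omega) (by omega)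
    have hs1 : (s : ℕ) + i ≡ j [MOD (p - 1)] := by
      have := s.2.1.add_right i
      rw [Nat.sub_add_cancel (by omega)] at this
      exact this.trans (by simp [Nat.ModEq])
    refine ⟨i, hi, s, ?_, ?_⟩
    · rwa [← hgcd, ← Nat.lcm]
    · apply (ZMod.chineseRemainder hcop).injective
      have hx : ZMod.chineseRemainder hcop x = ((g : ZMod p) ^ j, (g : ZMod q) ^ k) := by
        rw [hj, hk]; exact Prod.ext (Prod.fst_zmod_cast x) (Prod.snd_zmod_cast x)
      rw [hx, map_mul, map_pow, map_pow, map_natCast, map_natCast]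
      ext
      · simp only [Prod.fst_mul, Prod.pow_fst, Prod.fst_natCast, hu₁, ← pow_add]
        exact (pow_eq_pow_of_modEq hs1 (hg₁ ▸ pow_orderOf_eq_one _)).symm
      · simp only [Prod.snd_mul, Prod.pow_snd, Prod.snd_natCast, hu₂, one_pow, mul_one]
        exact (pow_eq_pow_of_modEq s.2.2 (hg₂ ▸ pow_orderOf_eq_one _)).symm

/-- The character sum over the set where `x` vanishes only modulo `p`, or has Jacobi symbol `-1`. -/
theorem two_mul_sum_add_one_sq {p q : ℕ} [Fact p.Prime] [Fact q.Prime] (hp : p ≠ 2) (hq : q ≠ 2)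
    (hpq : p ≠ q) {ζ : ℂ} (hζ : IsPrimitiveRoot ζ (p * q)) (C : Finset (ZMod (p * q)))
    (hC : ∀ x, x ∈ C ↔ ((x.cast : ZMod p) = 0 ∧ (x.cast : ZMod q) ≠ 0) ∨
      quadraticChar (ZMod p) x.cast * quadraticChar (ZMod q) x.cast = -1) :
    (2 * ∑ x ∈ C, ζ ^ x.val + 1) ^ 2 = ((ZMod.χ₄ ((p * q : ℕ) : ZMod 4) : ℤ) : ℂ) * (p * q : ℕ) := by
  have : NeZero (p * q) :=
    ⟨mul_ne_zero (Fact.out : p.Prime).ne_zero (Fact.out : q.Prime).ne_zero⟩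
  have hcop : Nat.Coprime p q := (Nat.coprime_primes Fact.out Fact.out).2 hpq
  let E := ZMod.chineseRemainder hcop
  let χ : AddChar (ZMod (p * q)) ℂ := AddChar.zmodChar (p * q) hζ.pow_eq_one
  have hχ : ∀ x, χ x = ζ ^ x.val := fun x ↦ AddChar.zmodChar_apply _ x
  have hχ1 : ∀ x, χ x = 1 → x = 0 := by
    intro x hx
    rw [hχ, hζ.pow_eq_one_iff_dvd] at hx
    exact (ZMod.val_eq_zero x).1 (Nat.eq_zero_of_dvd_of_lt hx x.val_lt)
  let φ : AddChar (ZMod p) ℂ := χ.compAddMonoidHom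
    ((E.symm : _ →+ _).comp (AddMonoidHom.inl (ZMod p) (ZMod q)))
  let ψ : AddChar (ZMod q) ℂ := χ.compAddMonoidHom
    ((E.symm : _ →+ _).comp (AddMonoidHom.inr (ZMod p) (ZMod q)))
  have hφ : φ ≠ 1 := by
    intro h
    have h1 := hχ1 (E.symm (1, 0)) (DFunLike.congr_fun h 1)
    simp at h1
  have hψ : ψ ≠ 1 := by
    intro h
    have h1 := hχ1 (E.symm (0, 1)) (DFunLike.congr_fun h 1)
    simp at h1
  have hsum : ∑ x ∈ C, ζ ^ x.val = ∑ z : ZMod p × ZMod q with (z.1 = 0 ∧ z.2 ≠ 0) ∨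
      quadraticChar (ZMod p) z.1 * quadraticChar (ZMod q) z.2 = -1, φ z.1 * ψ z.2 := by
    refine Finset.sum_equiv E.toEquiv (fun x ↦ ?_) fun x _ ↦ ?_
    · have h1 : (E x).1 = x.cast := Prod.fst_zmod_cast x
      have h2 : (E x).2 = x.cast := Prod.snd_zmod_cast x
      simp [hC, h1, h2]
    · have : x = E.symm ((E x).1, 0) + E.symm (0, (E x).2) := by
        rw [← map_add]; simp
      rw [← hχ]
      conv_lhs => rw [this, AddChar.map_add_eq_mul]
      rfl
  rw [hsum, two_mul_sum_filter_quadraticChar_add_one φ ψ hφ hψ, neg_sq, mul_pow,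
    gaussSum_quadraticChar_zmod_sq hp φ hφ, gaussSum_quadraticChar_zmod_sq hq ψ hψ]
  push_cast
  rw [map_mul]
  push_cast
  ring


theorem stmt_12
    (n₁ n₂ n e g u : ℕ)
    (hp₁ : n₁.Prime) (hp₂ : n₂.Prime)
    (hodd₁ : Odd n₁) (hodd₂ : Odd n₂) (hne : n₁ ≠ n₂)
    (h6 : Nat.gcd (n₁ - 1) (n₂ - 1) = 6)
    (hn : n = n₁ * n₂)
    (he : e = (n₁ - 1) * (n₂ - 1) / 6)
    (hg₁ : orderOf (g : ZMod n₁) = n₁ - 1)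
    (hg₂ : orderOf (g : ZMod n₂) = n₂ - 1)
    (hu₁ : (u : ZMod n₁) = (g : ZMod n₁))
    (hu₂ : (u : ZMod n₂) = 1)
    (W : ℕ → Finset (ZMod n))
    (hW : ∀ i, (W i : Set (ZMod n)) =
      {x | ∃ s < e, x = (g : ZMod n) ^ s * (u : ZMod n) ^ i})
    (P Q : Set (ZMod n))
    (hP : P = {x | ∃ k : ℕ, 1 ≤ k ∧ k ≤ n₂ - 1 ∧ x = ((k * n₁ : ℕ) : ZMod n)})
    (hQ : Q = {x | ∃ k : ℕ, 1 ≤ k ∧ k ≤ n₁ - 1 ∧ x = ((k * n₂ : ℕ) : ZMod n)})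
    (p a q m : ℕ) (hp : p.Prime) (ha : 0 < a) (hq : q = p ^ a)
    (hco : Nat.Coprime n q) (hm : m = orderOf (q : ZMod n))
    (F : Type) [Field F] [Fintype F] [CharP F p]
    (hF : Fintype.card F = q ^ m)
    (β : F) (hβ : IsPrimitiveRoot β n)
    (C₁ : Finset (ZMod n))
    (hC₁ : (C₁ : Set (ZMod n)) = P ∪ ↑(W 1) ∪ ↑(W 3) ∪ ↑(W 5))
    (Λβ : F) (hΛβ : Λβ = ∑ i ∈ C₁, β ^ i.val) :
    (n₁ * n₂ % 12 = 1 → Λβ * (Λβ + 1) = (((n - 1) / 4 : ℕ) : F)) ∧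
    (n₁ * n₂ % 12 = 7 → Λβ * (Λβ + 1) = -(((n + 1) / 4 : ℕ) : F)) := by
  subst hn
  have : Fact n₁.Prime := ⟨hp₁⟩
  have : Fact n₂.Prime := ⟨hp₂⟩
  have h₁ : n₁ ≠ 2 := by rintro rfl; exact absurd hodd₁ (by decide)
  have h₂ : n₂ ≠ 2 := by rintro rfl; exact absurd hodd₂ (by decide)
  have hn0 : 0 < n₁ * n₂ := Nat.mul_pos hp₁.pos hp₂.pos
  have hC : ∀ x, x ∈ C₁ ↔ ((x.cast : ZMod n₁) = 0 ∧ (x.cast : ZMod n₂) ≠ 0) ∨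
      quadraticChar (ZMod n₁) x.cast * quadraticChar (ZMod n₂) x.cast = -1 := by
    intro x
    rw [← zmod_exists_mul_iff hne, ← exists_odd_whiteman_iff hne h6 hg₁ hg₂ hu₁ hu₂,
      ← Finset.mem_coe, hC₁, hP, hW, hW, hW, he]
    simp only [Set.mem_union, Set.mem_ofPred_eq, or_and_right, exists_or, exists_eq_left, or_assoc]
  obtain ⟨ζ, hζ⟩ : ∃ ζ : ℂ, IsPrimitiveRoot ζ (n₁ * n₂) :=
    ⟨_, Complex.isPrimitiveRoot_exp _ hn0.ne'⟩
  have hsq := two_mul_sum_add_one_sq h₁ h₂ hne hζ C₁ hC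
  have transfer : ∀ c : ℤ, (2 * ∑ x ∈ C₁, ζ ^ x.val + 1) ^ 2 = 4 * (c : ℂ) + 1 →
      Λβ * (Λβ + 1) = c := by
    intro c hc
    have h := aeval_eq_zero_of_isPrimitiveRoot hn0 hζ hβ
      ((∑ x ∈ C₁, Polynomial.X ^ x.val) * (∑ x ∈ C₁, Polynomial.X ^ x.val + 1) - (c : Polynomial ℤ))
      (by simp only [map_sub, map_mul, map_add, map_sum, map_pow, Polynomial.aeval_X, map_one,
            map_intCast]
          linear_combination hc / 4)
    simp only [map_sub, map_mul, map_add, map_sum, map_pow, Polynomial.aeval_X, map_one,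
      map_intCast, ← hΛβ] at h
    exact sub_eq_zero.1 h
  constructor
  · intro h
    have h4 : n₁ * n₂ = 4 * ((n₁ * n₂ - 1) / 4) + 1 := by omega
    rw [ZMod.χ₄_nat_one_mod_four (by omega)] at hsq
    have := transfer ((n₁ * n₂ - 1) / 4 : ℕ) (by
      rw [hsq, Int.cast_one, one_mul]
      exact_mod_cast h4)
    rwa [Int.cast_natCast] at this
  · intro h
    have h4 : n₁ * n₂ + 1 = 4 * ((n₁ * n₂ + 1) / 4) := by omega
    rw [ZMod.χ₄_nat_three_mod_four (by omega)] at hsq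
    have h4' : ((n₁ * n₂ : ℕ) : ℂ) + 1 = 4 * ((n₁ * n₂ + 1) / 4 : ℕ) := by exact_mod_cast h4
    have := transfer (-((n₁ * n₂ + 1) / 4 : ℕ)) (by
      rw [hsq, Int.cast_neg, Int.cast_neg, Int.cast_one, Int.cast_natCast]
      linear_combination -h4')
    rwa [Int.cast_neg, Int.cast_natCast] at this
end

section
/- If either n ≡ 7 (mod 12) and p divides (n+1)/4, or n ≡ 1 (mod 12) and p divides (n−1)/4, then q mod n ∈ D₀. -/
open scoped NumberTheorySymbols in
/-- If `n ≡ -1` modulo `4 p`, then the Jacobi symbol `(p / n)` is `1`. -/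
theorem jacobiSym_prime_eq_one_of_dvd_add_one {p k : ℕ} (hp : p.Prime) (hk : p ∣ k) (hk0 : 0 < k) :
    J(p | 4 * k - 1) = 1 := by
  obtain ⟨c, rfl⟩ := hk
  have hodd : Odd (4 * (p * c) - 1) := by rw [Nat.odd_iff]; omega
  have h34 : (4 * (p * c) - 1) % 4 = 3 := by omega
  rcases hp.eq_two_or_odd with rfl | hp2
  · rw [Nat.cast_two, jacobiSym.at_two hodd, ZMod.χ₈_nat_mod_eight,
      show (4 * (2 * c) - 1) % 8 = 7 by omega]
    decide
  · have hneg : J((4 * (p * c) - 1 : ℕ) | p) = J(-1 | p) := by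
      apply jacobiSym.mod_left'
      apply Int.ModEq.symm
      rw [Int.modEq_iff_dvd, Nat.cast_sub (by omega)]
      exact ⟨4 * c, by push_cast; ring⟩
    have hpo : Odd p := Nat.odd_iff.2 hp2
    rcases Nat.odd_mod_four_iff.1 hp2 with h | h
    · rw [jacobiSym.quadratic_reciprocity_one_mod_four h hodd, hneg, jacobiSym.at_neg_one hpo,
        ZMod.χ₄_nat_one_mod_four h]
    · rw [jacobiSym.quadratic_reciprocity_three_mod_four h h34, hneg, jacobiSym.at_neg_one hpo,
        ZMod.χ₄_nat_three_mod_four h, neg_neg]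

open scoped NumberTheorySymbols in
/-- If `n ≡ 1` modulo `4 p`, then the Jacobi symbol `(p / n)` is `1`. -/
theorem jacobiSym_prime_eq_one_of_dvd_sub_one {p k : ℕ} (hp : p.Prime) (hk : p ∣ k) :
    J(p | 4 * k + 1) = 1 := by
  obtain ⟨c, rfl⟩ := hk
  have hodd : Odd (4 * (p * c) + 1) := by rw [Nat.odd_iff]; omega
  rcases hp.eq_two_or_odd with rfl | hp2
  · rw [Nat.cast_two, jacobiSym.at_two hodd, ZMod.χ₈_nat_mod_eight,
      show (4 * (2 * c) + 1) % 8 = 1 by omega]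
    decide
  · rw [← jacobiSym.quadratic_reciprocity_one_mod_four (by omega) (Nat.odd_iff.2 hp2),
      ← jacobiSym.one_left p]
    apply jacobiSym.mod_left'
    apply Int.ModEq.symm
    rw [Int.modEq_iff_dvd]
    exact ⟨4 * c, by push_cast; ring⟩

/-- The Legendre symbol of a unit modulo an odd prime is the parity of its discrete logarithm. -/
theorem exists_pow_eq_and_legendreSym_eq {ℓ g x : ℕ} [Fact ℓ.Prime] (hodd : Odd ℓ)
    (hg : orderOf (g : ZMod ℓ) = ℓ - 1) (hx : (x : ZMod ℓ) ≠ 0) :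
    ∃ s : ℕ, (x : ZMod ℓ) = (g : ZMod ℓ) ^ s ∧ legendreSym ℓ x = (-1) ^ s := by
  have hℓ : 2 < ℓ := by
    have := (Fact.out : ℓ.Prime).two_le
    have := Nat.odd_iff.1 hodd
    omega
  have hprim : IsPrimitiveRoot (g : ZMod ℓ) (ℓ - 1) := hg ▸ IsPrimitiveRoot.orderOf _
  have : NeZero (ℓ - 1) := ⟨by omega⟩
  obtain ⟨s, -, hs⟩ := hprim.eq_pow_of_pow_eq_one (ZMod.pow_card_sub_one_eq_one hx)
  have hg0 : (g : ZMod ℓ) ≠ 0 := hprim.ne_zero (by omega)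
  have hleg : legendreSym ℓ g = -1 := by
    refine (legendreSym.eq_one_or_neg_one ℓ (by simpa using hg0)).resolve_left fun h => ?_
    rw [legendreSym.eq_one_iff ℓ (by simpa using hg0), Int.cast_natCast,
      ZMod.euler_criterion ℓ hg0] at h
    have := Nat.le_of_dvd (by omega) (hprim.dvd_of_pow_eq_one _ h)
    omega
  refine ⟨s, hs.symm, ?_⟩
  have hcast : ((x : ℤ) : ZMod ℓ) = ((g : ℤ) ^ s : ℤ) := by push_cast; exact hs.symm
  have hpow : legendreSym ℓ ((g : ℤ) ^ s) = legendreSym ℓ g ^ s := map_pow (legendreSym.hom ℓ) _ _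
  rw [← hleg, ← hpow, legendreSym, legendreSym, hcast]

theorem stmt_13
    (n₁ n₂ n e g u : ℕ)
    (hp₁ : n₁.Prime) (hp₂ : n₂.Prime)
    (hodd₁ : Odd n₁) (hodd₂ : Odd n₂) (hne : n₁ ≠ n₂)
    (h6 : Nat.gcd (n₁ - 1) (n₂ - 1) = 6)
    (hn : n = n₁ * n₂)
    (he : e = (n₁ - 1) * (n₂ - 1) / 6)
    (hg₁ : orderOf (g : ZMod n₁) = n₁ - 1)
    (hg₂ : orderOf (g : ZMod n₂) = n₂ - 1)
    (hu₁ : (u : ZMod n₁) = (g : ZMod n₁))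
    (hu₂ : (u : ZMod n₂) = 1)
    (W : ℕ → Set (ZMod n))
    (hW : ∀ i, W i = {x | ∃ s < e, x = (g : ZMod n) ^ s * (u : ZMod n) ^ i})
    (D₀ D₁ : Set (ZMod n))
    (hD₀ : D₀ = W 0 ∪ W 2 ∪ W 4) (hD₁ : D₁ = W 1 ∪ W 3 ∪ W 5)
    (p a q : ℕ) (hp : p.Prime) (ha : 0 < a) (hq : q = p ^ a)
    (hco : Nat.Coprime n q)
    (hcase : (n % 12 = 7 ∧ p ∣ (n + 1) / 4) ∨ (n % 12 = 1 ∧ p ∣ (n - 1) / 4)) :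
    ((q : ℕ) : ZMod n) ∈ D₀ := by
  have := Fact.mk hp₁
  have := Fact.mk hp₂
  have hJp : jacobiSym p n = 1 := by
    rcases hcase with ⟨hmod, hdvd⟩ | ⟨hmod, hdvd⟩
    · have h := jacobiSym_prime_eq_one_of_dvd_add_one hp hdvd (by omega)
      rwa [show 4 * ((n + 1) / 4) - 1 = n by omega] at h
    · have h := jacobiSym_prime_eq_one_of_dvd_sub_one hp hdvd
      rwa [show 4 * ((n - 1) / 4) + 1 = n by omega] at h
  have hJ : legendreSym n₁ q * legendreSym n₂ q = 1 := by
    rw [jacobiSym.legendreSym.to_jacobiSym, jacobiSym.legendreSym.to_jacobiSym,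
      ← jacobiSym.mul_right, ← hn, hq, Nat.cast_pow, jacobiSym.pow_left, hJp, one_pow]
  rw [hn, Nat.coprime_mul_iff_left] at hco
  have hunit {ℓ : ℕ} [Fact ℓ.Prime] (h : ℓ.Coprime q) : (q : ZMod ℓ) ≠ 0 := by
    rw [Ne, ZMod.natCast_eq_zero_iff]
    exact ((Fact.out : ℓ.Prime).coprime_iff_not_dvd).1 h
  obtain ⟨s₁, hs₁, hl₁⟩ := exists_pow_eq_and_legendreSym_eq hodd₁ hg₁ (hunit hco.1)
  obtain ⟨s₂, hs₂, hl₂⟩ := exists_pow_eq_and_legendreSym_eq hodd₂ hg₂ (hunit hco.2)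
  have hparity : (s₁ + s₂) % 2 = 0 := by
    rw [hl₁, hl₂, ← pow_add, neg_one_pow_eq_one_iff_even (by norm_num)] at hJ
    exact Nat.even_iff.1 hJ
  have hd₁ : 6 ∣ n₁ - 1 := h6 ▸ Nat.gcd_dvd_left _ _
  have hd₂ : 6 ∣ n₂ - 1 := h6 ▸ Nat.gcd_dvd_right _ _
  have h1₁ := hp₁.two_le
  have h1₂ := hp₂.two_le
  obtain ⟨i, hi, hi6⟩ : ∃ i, (i = 0 ∨ i = 2 ∨ i = 4) ∧ (s₂ + i) % 6 = s₁ % 6 :=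
    ⟨(s₁ + 5 * s₂) % 6, by omega, by omega⟩
  have hcompat : s₁ + (n₁ - 1) - i ≡ s₂ [MOD Nat.gcd (n₁ - 1) (n₂ - 1)] := by
    rw [h6, Nat.ModEq]
    omega
  let s := Nat.chineseRemainder' hcompat
  have hse : (s : ℕ) < e := by
    have := Nat.chineseRemainder'_lt_lcm hcompat (by omega) (by omega)
    rwa [Nat.lcm, h6, ← he] at this
  have hqmem : (q : ZMod n) = (g : ZMod n) ^ (s : ℕ) * (u : ZMod n) ^ i := by
    have hmod₁ : (s : ℕ) + i ≡ s₁ [MOD n₁ - 1] := by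
      have h := s.2.1.add_right i
      rw [Nat.sub_add_cancel (by omega)] at h
      exact h.trans (by simp [Nat.ModEq])
    have e₁ : q ≡ g ^ (s : ℕ) * u ^ i [MOD n₁] := by
      rw [← ZMod.natCast_eq_natCast_iff]
      push_cast
      rw [hs₁, hu₁, ← pow_add]
      exact (pow_eq_pow_of_modEq hmod₁ (hg₁ ▸ pow_orderOf_eq_one _)).symm
    have e₂ : q ≡ g ^ (s : ℕ) * u ^ i [MOD n₂] := by
      rw [← ZMod.natCast_eq_natCast_iff]
      push_cast
      rw [hs₂, hu₂, one_pow, mul_one]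
      exact (pow_eq_pow_of_modEq s.2.2 (hg₂ ▸ pow_orderOf_eq_one _)).symm
    have h := (Nat.modEq_and_modEq_iff_modEq_mul ((Nat.coprime_primes hp₁ hp₂).2 hne)).1 ⟨e₁, e₂⟩
    rw [← hn, ← ZMod.natCast_eq_natCast_iff] at h
    exact_mod_cast h
  have hmem : (q : ZMod n) ∈ W i := by
    rw [hW]
    exact ⟨s, hse, hqmem⟩
  rw [hD₀]
  rcases hi with rfl | rfl | rfl
  · exact Or.inl (Or.inl hmem)
  · exact Or.inl (Or.inr hmem)
  · exact Or.inr hmem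
end

section
/- The cyclic code over GF(q) of length n with generator polynomial g(x) = (x^n−1)(x−1)/((x^{n₁}−1)(x^{n₂}−1)) has dimension n₁ + n₂ − 1 and minimum distance exactly min(n₁, n₂). -/
open Polynomial

/-- A function on `ZMod m` that is invariant under translation by a unit is constant. -/
theorem ZMod.eq_of_forall_add_natCast_eq {α : Type*} {m k : ℕ} [NeZero m] (h : k.Coprime m)
    (g : ZMod m → α) (hg : ∀ x, g (x + k) = g x) (x y : ZMod m) : g x = g y := by
  have hmul : ∀ (j : ℕ) (x : ZMod m), g (x + j * k) = g x := by
    intro j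
    induction j with
    | zero => simp
    | succ j ih =>
      intro x
      rw [Nat.cast_succ, add_mul, one_mul, ← add_assoc, hg, ih]
  have hk : (k : ZMod m) * (k : ZMod m)⁻¹ = 1 := ZMod.coe_mul_inv_eq_one k h
  have := hmul (((y - x) * (k : ZMod m)⁻¹).val) x
  rw [ZMod.natCast_zmod_val, mul_assoc, mul_comm _ (k : ZMod m), hk, mul_one,
    add_sub_cancel] at this
  exact this.symm

/-- The coefficients of a polynomial, collected by the residues of their exponents
modulo `a` and `b`. -/
noncomputable def Polynomial.coeffResidues {F : Type*} [Field F] (a b : ℕ) :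
    F[X] →ₗ[F] (ZMod a × ZMod b → F) :=
  Polynomial.lsum fun j => LinearMap.single F (fun _ => F) ((j : ZMod a), (j : ZMod b))

namespace Polynomial

variable {F : Type*} [Field F] {a b : ℕ}

theorem coeffResidues_monomial (j : ℕ) (r : F) :
    coeffResidues a b (monomial j r) = Pi.single ((j : ZMod a), (j : ZMod b)) r := by
  simp [coeffResidues, lsum_apply, sum_monomial_index]

theorem coeffResidues_apply (p : F[X]) (z : ZMod a × ZMod b) :
    coeffResidues a b p z =
      ∑ j ∈ p.support, if z = ((j : ZMod a), (j : ZMod b)) then p.coeff j else 0 := by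
  simp [coeffResidues, lsum_apply, sum_def, Finset.sum_apply, Pi.single_apply]

theorem coeffResidues_X_pow_mul (k : ℕ) (p : F[X]) (s : ZMod a) (t : ZMod b) :
    coeffResidues a b (X ^ k * p) (s + k, t + k) = coeffResidues a b p (s, t) := by
  induction p using Polynomial.induction_on' with
  | add p q hp hq => rw [mul_add, map_add, map_add, Pi.add_apply, Pi.add_apply, hp, hq]
  | monomial j r =>
    rw [X_pow_mul_monomial, coeffResidues_monomial, coeffResidues_monomial]
    simp [Pi.single_apply]

theorem card_filter_coeffResidues_le [DecidableEq F] [NeZero a] [NeZero b] (p : F[X]) :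
    (Finset.univ.filter fun z => coeffResidues a b p z ≠ 0).card ≤ p.support.card := by
  refine (Finset.card_le_card (t := p.support.image fun j : ℕ => ((j : ZMod a), (j : ZMod b)))
    fun z hz => ?_).trans Finset.card_image_le
  rw [Finset.mem_filter, coeffResidues_apply] at hz
  obtain ⟨j, hj, hne⟩ := Finset.exists_ne_zero_of_sum_ne_zero hz.2
  exact Finset.mem_image.2 ⟨j, hj, (ite_ne_right_iff.1 hne).1.symm⟩

theorem coeffResidues_natCast (hab : a.Coprime b) {p : F[X]} (hp : p.natDegree < a * b)
    {i : ℕ} (hi : i < a * b) : coeffResidues a b p (i, i) = p.coeff i := by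
  have hinj : ∀ j ∈ p.support,
      (((i : ZMod a), (i : ZMod b)) = ((j : ZMod a), (j : ZMod b)) ↔ i = j) := by
    intro j hj
    refine ⟨fun h => ?_, fun h => by rw [h]⟩
    rw [Prod.mk.injEq, ZMod.natCast_eq_natCast_iff, ZMod.natCast_eq_natCast_iff,
      Nat.modEq_and_modEq_iff_modEq_mul hab] at h
    exact h.eq_of_lt_of_lt hi ((le_natDegree_of_mem_supp j hj).trans_lt hp)
  rw [coeffResidues_apply, Finset.sum_congr rfl fun j hj => if_congr (hinj j hj) rfl rfl]
  simp +contextual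

theorem coeffResidues_X_pow_mul_sub_one_mul (p : F[X]) :
    coeffResidues a b ((X ^ (a * b) - 1) * p) = 0 := by
  ext ⟨s, t⟩
  have := coeffResidues_X_pow_mul (a * b) p s t
  simp only [Nat.cast_mul, CharP.cast_eq_zero, zero_mul, mul_zero, add_zero] at this
  simp [sub_mul, this]

/-- Codewords are sums of a function of the residue mod `a` and a function of the
residue mod `b`, expressed through vanishing mixed differences. -/
theorem coeffResidues_mixed_difference [NeZero a] [NeZero b] (hab : a.Coprime b) {p : F[X]}
    (h : X ^ (a * b) - 1 ∣ (X ^ a - 1) * (X ^ b - 1) * p) (s s' : ZMod a) (t t' : ZMod b) :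
    coeffResidues a b p (s, t) - coeffResidues a b p (s', t) =
      coeffResidues a b p (s, t') - coeffResidues a b p (s', t') := by
  obtain ⟨u, hu⟩ := h
  set f := coeffResidues a b p with hf
  have hrec : ∀ s t, f (s, t) - f (s + b, t) = f (s, t + a) - f (s + b, t + a) := by
    intro s t
    have h0 := congrFun (coeffResidues_X_pow_mul_sub_one_mul (a := a) (b := b) u)
      (s + (b : ZMod a), t + (a : ZMod b))
    have e : (X ^ a - 1) * (X ^ b - 1) * p =
      X ^ (a + b) * p - X ^ a * p - X ^ b * p + p := by ring
    rw [← hu, e] at h0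
    have h1 := coeffResidues_X_pow_mul (a := a) (b := b) (a + b) p s t
    have h2 := coeffResidues_X_pow_mul (a := a) (b := b) a p (s + b) t
    have h3 := coeffResidues_X_pow_mul (a := a) (b := b) b p s (t + a)
    simp only [Nat.cast_add, CharP.cast_eq_zero, zero_add, add_zero] at h1 h2 h3
    simp only [map_add, map_sub, Pi.add_apply, Pi.sub_apply, h1, h2, h3, ← hf,
      Pi.zero_apply] at h0
    linear_combination h0
  have hs : ∀ s s' t, f (s, t) - f (s, t + a) = f (s', t) - f (s', t + a) := fun s s' t =>
    ZMod.eq_of_forall_add_natCast_eq hab.symm (fun s => f (s, t) - f (s, t + a))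
      (fun s => by linear_combination -hrec s t) s s'
  exact ZMod.eq_of_forall_add_natCast_eq hab (fun t => f (s, t) - f (s', t))
    (fun t => by linear_combination -hs s s' t) t t'

theorem min_le_card_support_of_dvd [NeZero a] [NeZero b] (hab : a.Coprime b) {p : F[X]}
    (hp0 : p ≠ 0) (hp : p.natDegree < a * b)
    (h : X ^ (a * b) - 1 ∣ (X ^ a - 1) * (X ^ b - 1) * p) : min a b ≤ p.support.card := by
  classical
  refine le_trans ?_ (card_filter_coeffResidues_le (a := a) (b := b) p)
  have hmix := coeffResidues_mixed_difference hab h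
  have hne := coeffResidues_natCast hab hp hp
  set f := coeffResidues a b p
  set d := p.natDegree
  have hfd : f ((d : ZMod a), (d : ZMod b)) ≠ 0 := by
    rw [hne]; exact leadingCoeff_ne_zero.2 hp0
  by_cases hrow : ∀ t t', f (d, t) = f (d, t')
  · refine (min_le_right a b).trans ?_
    refine ((ZMod.card b).symm.trans Finset.card_univ.symm).le.trans ?_
    refine Finset.card_le_card_of_injOn (fun t => ((d : ZMod a), t)) (fun t _ => ?_)
      (fun t _ t' _ h => (Prod.mk.inj h).2)
    simpa [hrow t d] using hfd
  · push Not at hrow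
    obtain ⟨t, t', htt⟩ := hrow
    refine (min_le_left a b).trans ?_
    have hex : ∀ s, ∃ t, f (s, t) ≠ 0 := by
      intro s
      by_contra! h0
      refine htt ?_
      have := hmix d s t t'
      rwa [h0, h0, sub_zero, sub_zero] at this
    choose τ hτ using hex
    refine ((ZMod.card a).symm.trans Finset.card_univ.symm).le.trans ?_
    refine Finset.card_le_card_of_injOn (fun s => (s, τ s)) (fun s _ => by simpa using hτ s)
      (fun s _ s' _ h => (Prod.mk.inj h).1)

theorem card_support_geom_sum_X_pow (ha : a ≠ 0) :
    (∑ i ∈ Finset.range b, (X ^ a : F[X]) ^ i).support.card = b := by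
  have hs : (∑ i ∈ Finset.range b, (X ^ a : F[X]) ^ i).support =
      (Finset.range b).image (a * ·) := by
    ext j
    simp only [mem_support_iff, finsetSum_coeff, ← pow_mul, coeff_X_pow, Finset.mem_image]
    constructor
    · intro h
      obtain ⟨i, hi, hne⟩ := Finset.exists_ne_zero_of_sum_ne_zero h
      exact ⟨i, hi, (ite_ne_right_iff.1 hne).1.symm⟩
    · rintro ⟨i, hi, rfl⟩
      simp [ha, Finset.mem_range.1 hi]
  rw [hs, Finset.card_image_of_injective _ (mul_right_injective₀ ha), Finset.card_range]

theorem X_pow_sub_one_ne_zero (ha : a ≠ 0) : (X ^ a - 1 : F[X]) ≠ 0 := by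
  simpa using X_pow_sub_C_ne_zero (Nat.pos_of_ne_zero ha) (1 : F)

theorem natDegree_X_pow_sub_one : (X ^ a - 1 : F[X]).natDegree = a := by
  simpa using natDegree_X_pow_sub_C (n := a) (r := (1 : F))

/-- The weight `b` is attained by `(X ^ (a * b) - 1) / (X ^ a - 1)`. -/
theorem exists_dvd_card_support_eq (ha : a ≠ 0) (hb : b ≠ 0) {G : F[X]}
    (hG : G * ((X ^ a - 1) * (X ^ b - 1)) = (X ^ (a * b) - 1) * (X - 1)) :
    ∃ c : F[X], c ≠ 0 ∧ c.natDegree < a * b ∧ G ∣ c ∧ b = c.support.card := by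
  set A : F[X] := ∑ i ∈ Finset.range b, (X ^ a) ^ i with hA
  have hAm : A * (X ^ a - 1) = X ^ (a * b) - 1 := by rw [hA, geom_sum_mul, pow_mul]
  have ha0 := X_pow_sub_one_ne_zero (F := F) ha
  have hA0 : A ≠ 0 := left_ne_zero_of_mul (hAm.trans_ne (X_pow_sub_one_ne_zero (by positivity)))
  have hX : (X - 1 : F[X]) ≠ 0 := by simpa using X_sub_C_ne_zero (1 : F)
  refine ⟨A, hA0, ?_, ⟨∑ i ∈ Finset.range b, X ^ i, ?_⟩, (card_support_geom_sum_X_pow ha).symm⟩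
  · have := congrArg natDegree hAm
    rw [natDegree_mul hA0 ha0, natDegree_X_pow_sub_one, natDegree_X_pow_sub_one] at this
    omega
  · refine mul_right_cancel₀ (mul_ne_zero ha0 hX) ?_
    linear_combination (X - 1) * hAm - hG - G * (X ^ a - 1) * geom_sum_mul (X : F[X]) b

end Polynomial

theorem stmt_17
    (n₁ n₂ n : ℕ)
    (hp₁ : n₁.Prime) (hp₂ : n₂.Prime)
    (hodd₁ : Odd n₁) (hodd₂ : Odd n₂) (hne : n₁ ≠ n₂)
    (hn : n = n₁ * n₂)
    (q : ℕ) (hq : IsPrimePow q) (hco : Nat.Coprime n q)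
    (F : Type) [Field F] [Fintype F] (hF : Fintype.card F = q)
    (G : Polynomial F)
    (hG : G * ((X ^ n₁ - 1) * (X ^ n₂ - 1)) = (X ^ n - 1) * (X - 1)) :
    n - G.natDegree = n₁ + n₂ - 1 ∧
    IsLeast {w : ℕ | ∃ c : Polynomial F,
      c ≠ 0 ∧ c.natDegree < n ∧ G ∣ c ∧ w = c.support.card} (min n₁ n₂) := by
  subst hn
  have h₁ := hp₁.ne_zero
  have h₂ := hp₂.ne_zero
  have : NeZero n₁ := ⟨h₁⟩
  have : NeZero n₂ := ⟨h₂⟩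
  have hX : (X - 1 : F[X]) ≠ 0 := by simpa using X_sub_C_ne_zero (1 : F)
  have hXn := X_pow_sub_one_ne_zero (F := F) (mul_ne_zero h₁ h₂)
  refine ⟨?_, ?_, ?_⟩
  · have hG0 : G ≠ 0 := left_ne_zero_of_mul (hG.trans_ne (mul_ne_zero hXn hX))
    have hdeg := congrArg natDegree hG
    have hX1 : (X - 1 : F[X]).natDegree = 1 := by simpa using natDegree_X_sub_C (1 : F)
    rw [natDegree_mul hG0 (mul_ne_zero (X_pow_sub_one_ne_zero h₁) (X_pow_sub_one_ne_zero h₂)),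
      natDegree_mul (X_pow_sub_one_ne_zero h₁) (X_pow_sub_one_ne_zero h₂),
      natDegree_mul hXn hX, natDegree_X_pow_sub_one, natDegree_X_pow_sub_one,
      natDegree_X_pow_sub_one, hX1] at hdeg
    have := hp₁.two_le
    omega
  · rcases min_choice n₁ n₂ with h | h <;> rw [h]
    · rw [mul_comm n₁ n₂] at hG ⊢
      exact exists_dvd_card_support_eq h₂ h₁ (by rw [← hG]; ring)
    · exact exists_dvd_card_support_eq h₁ h₂ hG
  · rintro _ ⟨c, hc0, hc, ⟨u, rfl⟩, rfl⟩
    exact min_le_card_support_of_dvd ((Nat.coprime_primes hp₁ hp₂).2 hne) hc0 hc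
      ⟨(X - 1) * u, by linear_combination u * hG⟩
end
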